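/- arXiv:1806.10218 — 2 statements merged into one kernel-verified Lean document; each statement's English description precedes it below -/
import Mathlib

section
/- Let F be a surjective cellular automaton on A^ℤ with the uniform Bernoulli measure ν, and suppose the measure-preserving system (A^ℤ, ν, F) is ergodic. Then for every irrational real number α, the system (A^ℤ, ν, F) is not measure-theoretically isomorphic to the irrational circle rotation (ℝ/ℤ, Haar measure, x ↦ x + α); that is, there is no invertible measure-preserving map (mod null sets) φ : A^ℤ → ℝ/ℤ with φ ∘ F = R_α ∘ φ ν-almost everywhere, where R_α(x) = x + α. -/
open MeasureTheory Function Set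
open scoped Classical ENNReal

/-- The configuration space of a one-dimensional cellular automaton over the alphabet `A`. -/
abbrev Config (A : Type*) := ℤ → A

/-- The shift map `σ`, defined by `σ(x)_i = x_{i+1}`. -/
def shift {A : Type*} (x : Config A) : Config A := fun i => x (i + 1)

/-- The standard metric `d(x,y) = 2^{-n}` where
`n = min { i ≥ 0 : x_i ≠ y_i or x_{-i} ≠ y_{-i} }`, inducing the product topology. -/
noncomputable def cdist {A : Type*} (x y : Config A) : ℝ :=
  if x = y then 0
  else (2 : ℝ) ^ (-((sInf {n : ℕ | x (n : ℤ) ≠ y (n : ℤ) ∨ x (-(n : ℤ)) ≠ y (-(n : ℤ))} : ℕ) : ℤ))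

/-- `F` has radius `r`: there is a local rule `f : A^{2r+1} → A` with
`F(x)_i = f(x_{i-r}, ..., x_{i+r})`. -/
def HasRadius {A : Type*} (F : Config A → Config A) (r : ℕ) : Prop :=
  ∃ f : (Fin (2 * r + 1) → A) → A, ∀ (x : Config A) (i : ℤ),
    F x i = f (fun j => x (i - (r : ℤ) + (j : ℤ)))

/-- A map on `A^ℤ` is equicontinuous if the family of its iterates is uniformly
equicontinuous. -/
def EquicontMap {A : Type*} (F : Config A → Config A) : Prop :=
  ∀ ε > (0 : ℝ), ∃ δ > (0 : ℝ), ∀ x y : Config A, cdist x y < δ →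
    ∀ n : ℕ, cdist (F^[n] x) (F^[n] y) < ε

/-- `x` is an equicontinuous point of `F`. -/
def IsEquicontPt {A : Type*} (F : Config A → Config A) (x : Config A) : Prop :=
  ∀ ε > (0 : ℝ), ∃ δ > (0 : ℝ), ∀ y : Config A, cdist x y < δ →
    ∀ n : ℕ, cdist (F^[n] x) (F^[n] y) < ε

/-- `F` is sensitive to initial conditions. -/
def Sensitive {A : Type*} (F : Config A → Config A) : Prop :=
  ∃ ε > (0 : ℝ), ∀ x : Config A, ∀ δ > (0 : ℝ), ∃ y : Config A,
    cdist x y < δ ∧ ∃ n : ℕ, ε ≤ cdist (F^[n] x) (F^[n] y)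

/-- `w : A^L` is an `s`-blocking word for `F`. -/
def IsBlockingWord {A : Type*} (F : Config A → Config A) (s L : ℕ) (w : Fin L → A) : Prop :=
  s ≤ L ∧ ∃ p : ℕ, p + s ≤ L ∧ ∀ x y : Config A,
    (∀ j : Fin L, x (j : ℤ) = w j) → (∀ j : Fin L, y (j : ℤ) = w j) →
    ∀ n : ℕ, ∀ k : ℤ, (p : ℤ) ≤ k → k ≤ (p : ℤ) + (s : ℤ) →
      F^[n] x k = F^[n] y k

/-- The cylinder `[x(-n,n)]` of configurations agreeing with `x` on coordinates `-n, ..., n`. -/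
def cyl {A : Type*} (x : Config A) (n : ℕ) : Set (Config A) :=
  {y | ∀ j : ℤ, -(n : ℤ) ≤ j → j ≤ (n : ℤ) → y j = x j}

/-- The set `B_{[i₁,i₂]}(x) = {y : ∀ j ≥ 0, F^j(y)(i₁,i₂) = F^j(x)(i₁,i₂)}`. -/
def Bset {A : Type*} (F : Config A → Config A) (i₁ i₂ : ℤ) (x : Config A) : Set (Config A) :=
  {y | ∀ k : ℕ, ∀ j : ℤ, i₁ ≤ j → j ≤ i₂ → F^[k] y j = F^[k] x j}

/-- `ν` is the uniform Bernoulli measure: every cylinder determined by coordinates in a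
finite set `s` has measure `(1/|A|)^{|s|}`. -/
def IsUniformBernoulli {A : Type*} [Fintype A] [MeasurableSpace A]
    (ν : Measure (Config A)) : Prop :=
  ∀ (s : Finset ℤ) (u : ℤ → A),
    ν {x : Config A | ∀ i ∈ s, x i = u i} = ((Fintype.card A : ℝ≥0∞))⁻¹ ^ s.card

/-- `x` is a `ν`-equicontinuous point of `F` (Gilman). -/
def NuEquicontPt {A : Type*} [MeasurableSpace A] (F : Config A → Config A)
    (ν : Measure (Config A)) (x : Config A) : Prop :=
  ∀ m : ℕ, 0 < m → Filter.Tendsto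
    (fun n : ℕ => ν (cyl x n ∩ Bset F (-(m : ℤ)) (m : ℤ) x) / ν (cyl x n))
    Filter.atTop (nhds 1)

theorem shift_iterate_apply {A : Type*} (k : ℕ) (x : Config A) (i : ℤ) :
    shift^[k] x i = x (i + k) := by
  induction k generalizing x with
  | zero => simp
  | succ k ih =>
    rw [iterate_succ_apply, ih, shift]
    push_cast
    rw [add_assoc]

theorem measurable_shift {A : Type*} [MeasurableSpace A] : Measurable (shift (A := A)) :=
  measurable_pi_lambda _ fun i => measurable_pi_apply (i + 1)

/-- `piFinset (Icc (-n) n)` as a filtration indexed by `n : ℕ`. -/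
noncomputable def centralFiltration (A : Type*) [MeasurableSpace A] :
    Filtration ℕ (inferInstance : MeasurableSpace (Config A)) where
  seq n := Filtration.piFinset (X := fun _ : ℤ => A) (Finset.Icc (-(n : ℤ)) n)
  mono' m n hmn := Filtration.piFinset.mono (Finset.Icc_subset_Icc (by omega) (by omega))
  le' n := Filtration.piFinset.le _

theorem iSup_centralFiltration (A : Type*) [MeasurableSpace A] :
    ⨆ n, centralFiltration A n = (inferInstance : MeasurableSpace (Config A)) := by
  refine le_antisymm (iSup_le fun n => (centralFiltration A).le n) ?_
  refine iSup_le fun i => le_trans ?_ (le_iSup _ i.natAbs)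
  have hi : i ∈ Finset.Icc (-(i.natAbs : ℤ)) i.natAbs := by
    rw [Finset.mem_Icc]
    omega
  have h : (fun x : Config A => x i) =
      (fun y : Finset.Icc (-(i.natAbs : ℤ)) i.natAbs → A => y ⟨i, hi⟩) ∘
        (Finset.Icc (-(i.natAbs : ℤ)) i.natAbs).restrict := rfl
  rw [h, ← MeasurableSpace.comap_comp]
  exact MeasurableSpace.comap_mono (measurable_pi_apply _).comap_le

/-- Integrable observables are approximated in `L¹` by functions of finitely many coordinates. -/
theorem exists_stronglyMeasurable_eLpNorm_sub_le {A : Type*} [MeasurableSpace A]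
    {ν : Measure (Config A)} [IsFiniteMeasure ν] {f : Config A → ℂ} (hfm : Measurable f)
    (hf : Integrable f ν) {ε : ℝ≥0∞} (hε : ε ≠ 0) :
    ∃ (n : ℕ) (g : Config A → ℂ), StronglyMeasurable[centralFiltration A n] g ∧
      Integrable g ν ∧ eLpNorm (g - f) 1 ν ≤ ε := by
  have hre := hf.re.tendsto_eLpNorm_condExp (ℱ := centralFiltration A) (by
    rw [iSup_centralFiltration]
    exact (Complex.measurable_re.comp hfm).stronglyMeasurable)
  have him := hf.im.tendsto_eLpNorm_condExp (ℱ := centralFiltration A) (by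
    rw [iSup_centralFiltration]
    exact (Complex.measurable_im.comp hfm).stronglyMeasurable)
  have hsum := hre.add him
  rw [add_zero] at hsum
  obtain ⟨n, hn⟩ := (hsum.eventually (ge_mem_nhds (pos_iff_ne_zero.2 hε))).exists
  set u := ν[fun x => RCLike.re (f x) | centralFiltration A n]
  set v := ν[fun x => RCLike.im (f x) | centralFiltration A n]
  have hui : Integrable u ν := integrable_condExp
  have hvi : Integrable v ν := integrable_condExp
  refine ⟨n, fun x => (u x : ℂ) + v x * Complex.I, ?_, ?_, ?_⟩
  · exact (Complex.continuous_ofReal.comp_stronglyMeasurable stronglyMeasurable_condExp).add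
      ((Complex.continuous_ofReal.comp_stronglyMeasurable stronglyMeasurable_condExp).mul_const _)
  · exact hui.ofReal.add (hvi.ofReal.mul_const _)
  · refine le_trans ?_ hn
    refine le_trans (eLpNorm_mono_real (g := fun x => ‖u x - RCLike.re (f x)‖ +
      ‖v x - RCLike.im (f x)‖) fun x => ?_) (le_trans (eLpNorm_add_le
        (hui.sub hf.re).norm.aestronglyMeasurable (hvi.sub hf.im).norm.aestronglyMeasurable le_rfl) ?_)
    · refine (Complex.norm_le_abs_re_add_abs_im _).trans (le_of_eq ?_)
      simp
    · rw [eLpNorm_norm, eLpNorm_norm]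
      exact le_rfl

namespace IsUniformBernoulli

variable {A : Type*} [Fintype A] [MeasurableSpace A] {ν : Measure (Config A)}

theorem isProbabilityMeasure (hν : IsUniformBernoulli ν) [Nonempty A] :
    IsProbabilityMeasure ν :=
  ⟨by simpa using hν ∅ (fun _ => Classical.arbitrary A)⟩

/-- The values of `ν` on cylinders force the `σ`-algebra of the alphabet to be discrete. -/
theorem measurableSingletonClass (hν : IsUniformBernoulli ν) [Nonempty A] :
    MeasurableSingletonClass A := by
  have := hν.isProbabilityMeasure
  suffices h : ∀ a : A, measurableAtom a = {a} from
    ⟨fun a => h a ▸ MeasurableSet.measurableAtom_of_countable a⟩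
  intro a
  by_contra hne
  obtain ⟨b, hb, hba⟩ : ∃ b ∈ measurableAtom a, b ≠ a := by
    by_contra! h
    exact hne (Subset.antisymm h (by simp))
  have hcyl (c : A) : ν {x | x 0 = c} = (Fintype.card A : ℝ≥0∞)⁻¹ := by
    simpa using hν {0} (fun _ => c)
  have hsub : {x : Config A | x 0 = b} ⊆ toMeasurable ν {x | x 0 = a} := by
    intro x hx
    have hm : MeasurableSet ((fun t => update x 0 t) ⁻¹' toMeasurable ν {x : Config A | x 0 = a}) :=
      (measurable_update x) (measurableSet_toMeasurable _ _)
    have := mem_of_mem_measurableAtom hb hm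
      (subset_toMeasurable _ _ (by simp))
    simpa [← (show x 0 = b from hx)] using this
  have hcover : (univ : Set (Config A)) ⊆
      ⋃ c ∈ Finset.univ.erase b, toMeasurable ν {x | x 0 = c} := by
    intro x _
    simp only [mem_iUnion]
    by_cases hx : x 0 = b
    · exact ⟨a, by simpa using hba.symm, hsub hx⟩
    · exact ⟨x 0, by simpa using hx, subset_toMeasurable _ _ rfl⟩
  have hle : (1 : ℝ≥0∞) ≤ ((Fintype.card A - 1 : ℕ) : ℝ≥0∞) * (Fintype.card A : ℝ≥0∞)⁻¹ := by
    calc (1 : ℝ≥0∞) = ν univ := measure_univ.symm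
      _ ≤ ∑ c ∈ Finset.univ.erase b, ν (toMeasurable ν {x | x 0 = c}) :=
        (measure_mono hcover).trans (measure_biUnion_finset_le _ _)
      _ = _ := by simp [hcyl, Finset.card_erase_of_mem]
  have hlt : ((Fintype.card A - 1 : ℕ) : ℝ≥0∞) * (Fintype.card A : ℝ≥0∞)⁻¹ < 1 := by
    rw [← div_eq_mul_inv, ENNReal.div_lt_iff (by simp) (by simp), one_mul]
    exact_mod_cast Nat.sub_lt Fintype.card_pos one_pos
  exact hle.not_gt hlt

theorem eq_infinitePi (hν : IsUniformBernoulli ν) [Nonempty A] :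
    ν = Measure.infinitePi fun _ : ℤ => (Fintype.card A : ℝ≥0∞)⁻¹ • Measure.count := by
  have := hν.isProbabilityMeasure
  have := hν.measurableSingletonClass
  have hprob : IsProbabilityMeasure ((Fintype.card A : ℝ≥0∞)⁻¹ • (Measure.count : Measure A)) :=
    ⟨by simp [ENNReal.inv_mul_cancel]⟩
  refine IsProjectiveLimit.unique (P := fun I : Finset ℤ => Measure.pi fun _ : I =>
    (Fintype.card A : ℝ≥0∞)⁻¹ • (Measure.count : Measure A)) (fun I => ?_)
    (Measure.isProjectiveLimit_infinitePi _)
  refine Measure.ext_of_singleton fun w => ?_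
  rw [Measure.map_apply (Finset.measurable_restrict I) (measurableSet_singleton w),
    Measure.pi_singleton]
  have hset : I.restrict (π := fun _ => A) ⁻¹' {w} = {x : Config A | ∀ i ∈ I, x i =
      (if h : i ∈ I then w ⟨i, h⟩ else Classical.arbitrary A)} := by
    ext x
    simp only [mem_preimage, mem_singleton_iff, funext_iff, mem_ofPred_eq, Finset.restrict]
    refine ⟨fun h i hi => by simpa [hi] using h ⟨i, hi⟩, fun h i => by simpa using h i i.2⟩
  rw [hset, hν]
  simp

theorem map_shift (hν : IsUniformBernoulli ν) [Nonempty A] :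
    IsUniformBernoulli (ν.map shift) := by
  have := hν.measurableSingletonClass
  intro s u
  have hm : MeasurableSet {x : Config A | ∀ i ∈ s, x i = u i} := by
    have : {x : Config A | ∀ i ∈ s, x i = u i} = ⋂ i ∈ s, {x | x i = u i} := by
      ext
      simp
    rw [this]
    exact Finset.measurableSet_biInter _ fun i _ =>
      measurableSet_eq_fun (measurable_pi_apply i) measurable_const
  rw [Measure.map_apply measurable_shift hm]
  convert hν (s.map (Equiv.addRight 1).toEmbedding) (fun i => u (i - 1)) using 1
  · congr 1
    ext x
    simp only [shift, preimage_ofPred_eq, mem_ofPred_eq, Finset.forall_mem_map]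
    simp
  · simp

theorem measurePreserving_shift (hν : IsUniformBernoulli ν) [Nonempty A] :
    MeasurePreserving shift ν ν :=
  ⟨measurable_shift, hν.map_shift.eq_infinitePi.trans hν.eq_infinitePi.symm⟩

theorem iIndepFun_apply (hν : IsUniformBernoulli ν) [Nonempty A] :
    ProbabilityTheory.iIndepFun (fun (i : ℤ) (x : Config A) => x i) ν := by
  have hprob : IsProbabilityMeasure ((Fintype.card A : ℝ≥0∞)⁻¹ • (Measure.count : Measure A)) :=
    ⟨by have := hν.measurableSingletonClass; simp [ENNReal.inv_mul_cancel]⟩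
  rw [hν.eq_infinitePi]
  exact ProbabilityTheory.iIndepFun_infinitePi (X := fun _ a => a) fun _ => measurable_id

/-- The window `[-n, n]` and its translate by `2n + 1` are independent. -/
theorem indep_comap_shift_iterate (hν : IsUniformBernoulli ν) [Nonempty A] (n : ℕ) :
    ProbabilityTheory.Indep ((centralFiltration A n).comap shift^[2 * n + 1])
      (centralFiltration A n) ν := by
  have h := hν.iIndepFun_apply.indepFun_finset (Finset.Icc ((n : ℤ) + 1) (3 * n + 1))
    (Finset.Icc (-(n : ℤ)) n)
    (Finset.disjoint_left.2 fun i => by simp only [Finset.mem_Icc]; omega)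
    fun i => measurable_pi_apply i
  refine ProbabilityTheory.indep_of_indep_of_le_left h ?_
  have hfac : (Finset.Icc (-(n : ℤ)) n).restrict ∘ shift^[2 * n + 1] =
      (fun (y : Finset.Icc ((n : ℤ) + 1) (3 * n + 1) → A) (i : Finset.Icc (-(n : ℤ)) n) =>
        y ⟨i + (2 * n + 1), by have := Finset.mem_Icc.1 i.2; rw [Finset.mem_Icc]; omega⟩) ∘
      fun (x : Config A) i => x i := by
    ext x i
    simp only [comp_apply, Finset.restrict, shift_iterate_apply]
    push_cast
    rfl
  change ((MeasurableSpace.pi.comap (Finset.Icc (-(n : ℤ)) n).restrict).comap _) ≤ _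
  rw [MeasurableSpace.comap_comp, hfac, ← MeasurableSpace.comap_comp]
  exact MeasurableSpace.comap_mono
    (measurable_pi_lambda _ fun i => measurable_pi_apply _).comap_le

/-- The shift has no nonzero eigenfunction of mean zero. -/
theorem eLpNorm_eq_zero_of_comp_shift_iterate (hν : IsUniformBernoulli ν) [Nonempty A]
    {f : Config A → ℂ} (hfm : Measurable f) (hf : Integrable f ν) (hf0 : ∫ x, f x ∂ν = 0)
    (heig : ∀ k : ℕ, ∃ c : ℂ, ‖c‖ = 1 ∧ f =ᵐ[ν] c • (f ∘ shift^[k])) :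
    eLpNorm f 1 ν = 0 := by
  have := hν.isProbabilityMeasure
  suffices h : ∀ ε : ℝ≥0∞, ε ≠ 0 → eLpNorm f 1 ν ≤ 4 * ε by
    by_contra hne
    have hfin : eLpNorm f 1 ν ≠ ∞ := (memLp_one_iff_integrable.2 hf).eLpNorm_ne_top
    have h5 := h (eLpNorm f 1 ν / 5) (by simp [hne])
    lift eLpNorm f 1 ν to NNReal using hfin with r
    have hr : (r : ℝ) ≠ 0 := by exact_mod_cast hne
    have h5' : (r : ℝ) ≤ 4 * (r / 5) := by
      rw [show (5 : ℝ≥0∞) = ((5 : NNReal) : ℝ≥0∞) by rfl,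
        ← ENNReal.coe_div (by norm_num)] at h5
      exact_mod_cast h5
    have : (0 : ℝ) < r := lt_of_le_of_ne r.2 hr.symm
    linarith
  intro ε hε
  obtain ⟨n, g, hgm, hg, hgf⟩ := exists_stronglyMeasurable_eLpNorm_sub_le hfm hf hε
  obtain ⟨c, hc, hfc⟩ := heig (2 * n + 1)
  have hS := hν.measurePreserving_shift.iterate (2 * n + 1)
  set S := (shift^[2 * n + 1] : Config A → Config A)
  have hgS : Integrable (g ∘ S) ν := hS.integrable_comp_of_integrable hg
  have hshift : eLpNorm (c • (g ∘ S) - f) 1 ν ≤ ε := by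
    have h1 : c • (g ∘ S) - f =ᵐ[ν] c • ((g - f) ∘ S) := by
      filter_upwards [hfc] with x hx
      simp only [Pi.sub_apply, Pi.smul_apply, comp_apply] at hx ⊢
      rw [hx, smul_sub]
    rw [eLpNorm_congr_ae h1, eLpNorm_const_smul,
      eLpNorm_comp_measurePreserving (hg.sub hf).aestronglyMeasurable hS]
    simpa [← ofReal_norm, hc] using hgf
  have hmean : ‖∫ x, g x ∂ν‖ₑ ≤ ε := by
    have h1 : ∫ x, g x ∂ν = ∫ x, (g - f) x ∂ν := by
      simp only [Pi.sub_apply]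
      rw [integral_sub hg hf, hf0, sub_zero]
    rw [h1]
    refine (enorm_integral_le_lintegral_enorm _).trans ?_
    rwa [← eLpNorm_one_eq_lintegral_enorm]
  have hdiff : eLpNorm (g - c • (g ∘ S)) 1 ν ≤ 2 * ε := by
    have h1 : g - c • (g ∘ S) = (g - f) - (c • (g ∘ S) - f) := by abel
    rw [h1, two_mul]
    exact (eLpNorm_sub_le (hg.sub hf).aestronglyMeasurable
      ((hgS.smul c).sub hf).aestronglyMeasurable le_rfl).trans (add_le_add hgf hshift)
  have hm := (centralFiltration A).le n
  have hcond : ν[g - c • (g ∘ S) | centralFiltration A n] =ᵐ[ν]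
      g - fun _ => c • ∫ x, g x ∂ν := by
    have hind := condExp_indep_eq (f := g ∘ S)
      ((MeasurableSpace.comap_mono hm).trans hS.measurable.comap_le) hm
      (hgm.comp_measurable (comap_measurable S)) (hν.indep_comap_shift_iterate n)
    have hint : ∫ x, (g ∘ S) x ∂ν = ∫ x, g x ∂ν := by
      have h := integral_map hS.aemeasurable (hS.map_eq.symm ▸ hg.aestronglyMeasurable)
      rw [hS.map_eq] at h
      exact h.symm
    filter_upwards [condExp_sub hg (hgS.smul c) (centralFiltration A n),
      condExp_smul c (g ∘ S) (centralFiltration A n) (μ := ν), hind] with x h1 h2 h3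
    rw [h1, Pi.sub_apply, h2, Pi.smul_apply, h3, hint,
      condExp_of_stronglyMeasurable hm hgm hg]
    rfl
  have hcentered : eLpNorm (g - fun _ => c • ∫ x, g x ∂ν) 1 ν ≤ 2 * ε := by
    rw [← eLpNorm_congr_ae hcond]
    exact (eLpNorm_condExp_le_eLpNorm _ le_rfl).trans hdiff
  have hconst : eLpNorm (fun _ : Config A => c • ∫ x, g x ∂ν) 1 ν ≤ ε := by
    rw [eLpNorm_const _ one_ne_zero (IsProbabilityMeasure.ne_zero ν)]
    simpa [enorm_mul, ← ofReal_norm c, hc] using hmean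
  have hconstm : AEStronglyMeasurable (fun _ : Config A => c • ∫ x, g x ∂ν) ν :=
    aestronglyMeasurable_const
  have hdecomp : f = ((g - fun _ => c • ∫ x, g x ∂ν) + fun _ => c • ∫ x, g x ∂ν) - (g - f) := by
    abel
  calc eLpNorm f 1 ν
      ≤ (2 * ε + ε) + ε := by
        conv_lhs => rw [hdecomp]
        refine (eLpNorm_sub_le ((hg.aestronglyMeasurable.sub hconstm).add hconstm)
          (hg.sub hf).aestronglyMeasurable le_rfl).trans (add_le_add ?_ hgf)
        exact (eLpNorm_add_le (hg.aestronglyMeasurable.sub hconstm) hconstm le_rfl).trans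
          (add_le_add hcentered hconst)
    _ = 4 * ε := by ring

end IsUniformBernoulli

/-- An ergodic surjective cellular automaton (with the uniform Bernoulli
measure) is not measure-theoretically isomorphic to any irrational rotation of the circle
`ℝ/ℤ` with its Haar (probability) measure. -/
theorem ergodic_CA_not_isomorphic_to_irrational_rotation
    {A : Type*} [Fintype A] [Nonempty A] [MeasurableSpace A]
    [TopologicalSpace A] [DiscreteTopology A]
    (F : Config A → Config A) (hFcont : Continuous F)
    (hFshift : F ∘ shift = shift ∘ F) (hsurj : Function.Surjective F)
    (ν : MeasureTheory.Measure (Config A)) (hν : IsUniformBernoulli ν)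
    (herg : Ergodic F ν) (α : ℝ) (hα : Irrational α) :
    ¬ ∃ (φ : Config A → UnitAddCircle) (ψ : UnitAddCircle → Config A),
      MeasureTheory.MeasurePreserving φ ν
        (MeasureTheory.volume : MeasureTheory.Measure UnitAddCircle) ∧
      MeasureTheory.MeasurePreserving ψ
        (MeasureTheory.volume : MeasureTheory.Measure UnitAddCircle) ν ∧
      (∀ᵐ z ∂ν, ψ (φ z) = z) ∧
      (∀ᵐ w ∂(MeasureTheory.volume : MeasureTheory.Measure UnitAddCircle), φ (ψ w) = w) ∧
      (∀ᵐ z ∂ν, φ (F z) = φ z + (α : UnitAddCircle)) := by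
  rintro ⟨φ, -, hφ, -, -, -, hφF⟩
  have := hν.isProbabilityMeasure
  have hσ := hν.measurePreserving_shift
  have hinv : (fun z => φ (shift z) - φ z) ∘ F =ᵐ[ν] fun z => φ (shift z) - φ z := by
    filter_upwards [hφF, hσ.quasiMeasurePreserving.ae hφF] with z h1 h2
    have hcomm : shift (F z) = F (shift z) := (congrFun hFshift z).symm
    simp only [comp_apply]
    rw [hcomm, h1, h2]
    abel
  obtain ⟨β, hβ⟩ := herg.ae_eq_const_of_ae_eq_comp_ae
    ((hφ.measurable.comp hσ.measurable).sub hφ.measurable).aestronglyMeasurable hinv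
  have hiter (k : ℕ) : ∀ᵐ z ∂ν, φ (shift^[k] z) = φ z + k • β := by
    induction k with
    | zero => simp
    | succ k ih =>
      filter_upwards [ih, (hσ.iterate k).quasiMeasurePreserving.ae hβ] with z h1 h2
      have h3 : φ (shift (shift^[k] z)) = β + φ (shift^[k] z) := sub_eq_iff_eq_add.1 h2
      rw [iterate_succ_apply', h3, h1, succ_nsmul]
      abel
  set f : Config A → ℂ := fun z => fourier 1 (φ z) with hfdef
  have hfm : Measurable f := (fourier 1).continuous.measurable.comp hφ.measurable
  have hnorm (z : Config A) : ‖f z‖ = 1 := by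
    simp only [hfdef, fourier_apply, Circle.norm_coe]
  have hf : Integrable f ν :=
    .of_bound hfm.aestronglyMeasurable 1 (.of_forall fun z => (hnorm z).le)
  have hf0 : ∫ z, f z ∂ν = 0 := by
    rw [← integral_map (f := fun w : UnitAddCircle => (fourier 1 w : ℂ)) hφ.aemeasurable
      (fourier 1).continuous.aestronglyMeasurable, hφ.map_eq]
    exact integral_eq_zero_of_add_right_eq_neg (fourier_add_half_inv_index one_ne_zero one_pos)
  have hzero := hν.eLpNorm_eq_zero_of_comp_shift_iterate hfm hf hf0 fun k => by
    refine ⟨fourier 1 (-(k • β)), by rw [fourier_apply, Circle.norm_coe], ?_⟩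
    filter_upwards [hiter k] with z hz
    simp only [hfdef, Pi.smul_apply, comp_apply, hz, fourier_apply, one_zsmul, smul_eq_mul]
    rw [← Circle.coe_mul, ← AddCircle.toCircle_add, neg_add_cancel_comm_assoc]
  rw [eLpNorm_eq_zero_iff hfm.aestronglyMeasurable one_ne_zero] at hzero
  obtain ⟨z, hz⟩ := hzero.exists
  simpa [hz] using hnorm z
end

section
/- Let F be a cellular automaton on A^ℤ and μ a Borel probability measure on A^ℤ that is invariant under both the shift σ and F, ergodic for σ, and ergodic for F. If (A^ℤ, σ, μ) is measure-theoretically weakly mixing (i.e., σ × σ is ergodic on (A^ℤ × A^ℤ, μ × μ)), then (A^ℤ, F, μ) is also weakly mixing (F × F is ergodic on (A^ℤ × A^ℤ, μ × μ)). -/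
open MeasureTheory Function Set
open scoped Classical ENNReal

/-- A countable product of countably generated measurable spaces is countably generated. -/
theorem countablyGenerated_pi {ι : Type*} [Countable ι] {X : ι → Type*}
    [∀ i, MeasurableSpace (X i)] [∀ i, MeasurableSpace.CountablyGenerated (X i)] :
    MeasurableSpace.CountablyGenerated (∀ i, X i) := by
  have h : ∀ i, ∃ b : Set (Set (∀ i, X i)), b.Countable ∧
      MeasurableSpace.comap (fun x : ∀ i, X i => x i) inferInstance =
        MeasurableSpace.generateFrom b := fun i =>
    (MeasurableSpace.CountablyGenerated.comap (fun x : ∀ i, X i => x i)).isCountablyGenerated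
  choose b hb hgen using h
  refine ⟨⋃ i, b i, countable_iUnion hb, ?_⟩
  rw [← MeasurableSpace.iSup_generateFrom]
  exact iSup_congr hgen

/-- Some iterate of an ergodic map moves a given non-null set into another one on a
non-null set of points. -/
theorem Ergodic.exists_measure_inter_preimage_iterate_ne_zero {X : Type*} [MeasurableSpace X]
    {μ : Measure X} [IsFiniteMeasure μ] {f : X → X} (hf : Ergodic f μ) {s t : Set X}
    (hs : μ s ≠ 0) (ht : MeasurableSet t) (ht₀ : μ t ≠ 0) :
    ∃ n : ℕ, μ (s ∩ f^[n] ⁻¹' t) ≠ 0 := by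
  by_contra! h
  have hU : MeasurableSet (⋃ n : ℕ, f^[n] ⁻¹' t) :=
    .iUnion fun n => hf.measurable.iterate n ht
  have hsub : f ⁻¹' (⋃ n : ℕ, f^[n] ⁻¹' t) ⊆ ⋃ n : ℕ, f^[n] ⁻¹' t := by
    rw [preimage_iUnion]
    exact iUnion_subset fun n => subset_iUnion (fun n : ℕ => f^[n] ⁻¹' t) (n + 1)
  have hnull : μ (s ∩ ⋃ n : ℕ, f^[n] ⁻¹' t) = 0 := by
    rw [inter_iUnion]
    exact measure_iUnion_null h
  rcases hf.ae_empty_or_univ_of_preimage_ae_le hU.nullMeasurableSet hsub.eventuallyLE with h' | h'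
  · refine ht₀ (measure_mono_null ?_ (measure_congr h' |>.trans measure_empty))
    exact subset_iUnion (fun n : ℕ => f^[n] ⁻¹' t) 0
  · apply hs
    rw [← hnull, measure_congr ((Filter.EventuallyEq.refl _ s).inter h'), inter_univ]

section CommutingMaps

open scoped symmDiff

variable {X : Type*} [MeasurableSpace X] {μ : Measure X} [IsProbabilityMeasure μ]
  {S T : X → X} {E : Set (X × X)}

/-- The distance between the sections of an invariant set at `x` and at `S^[n] x` is almost
everywhere constant. -/
theorem exists_ae_measure_symmDiff_section_iterate_eq (hS : Measurable S) (hT : Ergodic T μ)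
    (hcomm : Function.Commute T S) (hE : MeasurableSet E) (hinv : Prod.map T T ⁻¹' E = E) (n : ℕ) :
    ∃ c : ℝ≥0∞, ∀ᵐ x ∂μ, μ ((Prod.mk x ⁻¹' E) ∆ (Prod.mk (S^[n] x) ⁻¹' E)) = c := by
  have hmeas : Measurable fun x => μ ((Prod.mk x ⁻¹' E) ∆ (Prod.mk (S^[n] x) ⁻¹' E)) :=
    measurable_measure_prodMk_left (s := E ∆ (Prod.map S^[n] id ⁻¹' E))
      (hE.symmDiff (((hS.iterate n).prodMap measurable_id) hE))
  refine hT.toPreErgodic.ae_eq_const_of_ae_eq_comp hmeas (funext fun x => ?_)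
  have hsec : ∀ y, T ⁻¹' (Prod.mk (T y) ⁻¹' E) = Prod.mk y ⁻¹' E := fun y =>
    congrArg (Prod.mk y ⁻¹' ·) hinv
  have hsecm : ∀ y, MeasurableSet (Prod.mk y ⁻¹' E) := fun y => measurable_prodMk_left hE
  simp only [Function.comp_apply]
  rw [← hT.measure_preimage ((hsecm _).symmDiff (hsecm _)).nullMeasurableSet, preimage_symmDiff,
    ← (hcomm.iterate_right n).eq, hsec, hsec]

/-- If `S` is weakly mixing and commutes with the ergodic map `T`, then almost all sections of a
`T × T`-invariant set are close to one another. -/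
theorem exists_ae_measure_symmDiff_section_le [IsSeparable μ]
    (hS : Ergodic (Prod.map S S) (μ.prod μ)) (hSm : Measurable S) (hT : Ergodic T μ)
    (hcomm : Function.Commute T S) (hE : MeasurableSet E) (hinv : Prod.map T T ⁻¹' E = E)
    {ε : ℝ} (hε : 0 < ε) :
    ∃ t : Set X, ∀ᵐ x ∂μ, μ ((Prod.mk x ⁻¹' E) ∆ t) ≤ 5 * ENNReal.ofReal ε := by
  obtain ⟨𝒜, hcount, hdense⟩ := exists_countable_measureDense μ
  let B : Set X → Set X := fun t => {x | μ ((Prod.mk x ⁻¹' E) ∆ t) < ENNReal.ofReal ε}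
  have hB : ∀ t ∈ 𝒜, MeasurableSet (B t) := fun t ht =>
    measurableSet_lt (measurable_measure_prodMk_left (s := E ∆ (Prod.snd ⁻¹' t))
      (hE.symmDiff (measurable_snd (hdense.measurable t ht)))) measurable_const
  have hpos : ∀ᵐ x ∂μ, ∃ t ∈ 𝒜, x ∈ B t ∧ μ (B t) ≠ 0 := by
    have hnull : ∀ᵐ x ∂μ, ∀ t ∈ 𝒜, x ∈ B t → μ (B t) ≠ 0 := by
      refine (ae_ball_iff hcount).2 fun t _ => ?_
      by_cases h : μ (B t) = 0
      · filter_upwards [measure_eq_zero_iff_ae_notMem.1 h] with x hx hx' using absurd hx' hx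
      · exact .of_forall fun _ _ => h
    filter_upwards [hnull] with x hx
    obtain ⟨t, ht, hxt⟩ := hdense.approx (Prod.mk x ⁻¹' E) (measurable_prodMk_left hE)
      (measure_ne_top μ _) ε hε
    exact ⟨t, ht, hxt, hx t ht hxt⟩
  obtain ⟨-, t₀, ht₀, -, hμt₀⟩ := hpos.exists
  refine ⟨t₀, ?_⟩
  filter_upwards [hpos] with x ⟨t, ht, hxt, hμt⟩
  obtain ⟨n, hn⟩ := hS.exists_measure_inter_preimage_iterate_ne_zero
    (s := B t₀ ×ˢ B t₀) (t := B t₀ ×ˢ B t) (by simp [hμt₀])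
    ((hB t₀ ht₀).prod (hB t ht)) (by simp [hμt₀, hμt])
  rw [Prod.map_iterate, preimage_prod_map_prod, prod_inter_prod, Measure.prod_prod] at hn
  obtain ⟨c, hc⟩ := exists_ae_measure_symmDiff_section_iterate_eq hSm hT hcomm hE hinv n
  have hexists : ∀ {s : Set X}, μ s ≠ 0 →
      ∃ y ∈ s, μ ((Prod.mk y ⁻¹' E) ∆ (Prod.mk (S^[n] y) ⁻¹' E)) = c := fun hs =>
    ((frequently_ae_mem_iff.2 hs).and_eventually hc).exists
  obtain ⟨y, ⟨hy, hSy⟩, hyc⟩ := hexists (left_ne_zero_of_mul hn)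
  obtain ⟨z, ⟨hz, hSz⟩, hzc⟩ := hexists (right_ne_zero_of_mul hn)
  have hc_le : c ≤ ENNReal.ofReal ε + ENNReal.ofReal ε := by
    rw [← hyc]
    refine (measure_symmDiff_le _ t₀ _).trans (add_le_add hy.le ?_)
    rw [symmDiff_comm]
    exact hSy.le
  have hSz' : μ (t ∆ (Prod.mk (S^[n] z) ⁻¹' E)) ≤ ENNReal.ofReal ε := by
    rw [symmDiff_comm]
    exact hSz.le
  have hzc' : μ ((Prod.mk (S^[n] z) ⁻¹' E) ∆ (Prod.mk z ⁻¹' E)) ≤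
      ENNReal.ofReal ε + ENNReal.ofReal ε := by
    rw [symmDiff_comm, hzc]
    exact hc_le
  calc μ ((Prod.mk x ⁻¹' E) ∆ t₀)
      ≤ μ ((Prod.mk x ⁻¹' E) ∆ t) + (μ (t ∆ (Prod.mk (S^[n] z) ⁻¹' E)) +
          (μ ((Prod.mk (S^[n] z) ⁻¹' E) ∆ (Prod.mk z ⁻¹' E)) + μ ((Prod.mk z ⁻¹' E) ∆ t₀))) :=
        (measure_symmDiff_le _ t _).trans <| add_le_add_right
          ((measure_symmDiff_le _ _ _).trans <| add_le_add_right (measure_symmDiff_le _ _ _) _) _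
    _ ≤ ENNReal.ofReal ε + (ENNReal.ofReal ε +
          ((ENNReal.ofReal ε + ENNReal.ofReal ε) + ENNReal.ofReal ε)) :=
        add_le_add hxt.le (add_le_add hSz' (add_le_add hzc' hz.le))
    _ = 5 * ENNReal.ofReal ε := by ring

/-- If `S` is weakly mixing and commutes with the ergodic map `T`, then almost all sections of a
`T × T`-invariant set agree up to null sets. -/
theorem exists_ae_section_ae_eq [IsSeparable μ]
    (hS : Ergodic (Prod.map S S) (μ.prod μ)) (hSm : Measurable S) (hT : Ergodic T μ)
    (hcomm : Function.Commute T S) (hE : MeasurableSet E) (hinv : Prod.map T T ⁻¹' E = E) :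
    ∃ G : Set X, MeasurableSet G ∧ ∀ᵐ x ∂μ, Prod.mk x ⁻¹' E =ᵐ[μ] G := by
  choose t ht using fun k : ℕ => exists_ae_measure_symmDiff_section_le hS hSm hT hcomm hE hinv
    (Nat.one_div_pos_of_nat (α := ℝ) (n := k))
  rw [← ae_all_iff] at ht
  obtain ⟨x₀, hx₀⟩ := ht.exists
  refine ⟨Prod.mk x₀ ⁻¹' E, measurable_prodMk_left hE, ?_⟩
  filter_upwards [ht] with x hx
  rw [← measure_symmDiff_eq_zero_iff]
  have hlim : Filter.Tendsto (fun k : ℕ => 5 * ENNReal.ofReal (1 / ((k : ℝ) + 1)) +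
      5 * ENNReal.ofReal (1 / ((k : ℝ) + 1))) Filter.atTop (nhds 0) := by
    have h := ENNReal.Tendsto.const_mul (a := 5)
      (ENNReal.tendsto_ofReal (tendsto_one_div_add_atTop_nhds_zero_nat (𝕜 := ℝ)))
      (Or.inr (by simp))
    simpa using h.add h
  refine le_antisymm (ge_of_tendsto' hlim fun k => ?_) bot_le
  refine (measure_symmDiff_le _ (t k) _).trans (add_le_add (hx k) ?_)
  rw [symmDiff_comm]
  exact hx₀ k

/-- An ergodic map commuting with a weakly mixing map is weakly mixing. -/
theorem Ergodic.prodMap_self_of_commute [IsSeparable μ]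
    (hT : Ergodic T μ) (hS : Ergodic (Prod.map S S) (μ.prod μ)) (hSm : Measurable S)
    (hcomm : Function.Commute T S) : Ergodic (Prod.map T T) (μ.prod μ) := by
  refine ⟨hT.toMeasurePreserving.prod hT.toMeasurePreserving, ⟨fun E hE hinv => ?_⟩⟩
  obtain ⟨G, hG, hsec⟩ := exists_ae_section_ae_eq hS hSm hT hcomm hE hinv
  have hGinv : T ⁻¹' G =ᵐ[μ] G := by
    obtain ⟨x, hx, hTx⟩ := (hsec.and (hT.quasiMeasurePreserving.ae hsec)).exists
    have h : T ⁻¹' (Prod.mk (T x) ⁻¹' E) = Prod.mk x ⁻¹' E := congrArg (Prod.mk x ⁻¹' ·) hinv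
    exact ((hT.quasiMeasurePreserving.preimage_ae_eq hTx).symm.trans h.eventuallyEq).trans hx
  rw [Filter.eventuallyConst_set']
  rcases hT.quasiErgodic.ae_empty_or_univ₀ hG.nullMeasurableSet hGinv with h | h
  · left
    rw [ae_eq_empty, Measure.measure_prod_null hE]
    filter_upwards [hsec] with x hx using ae_eq_empty.1 (hx.trans h)
  · right
    rw [ae_eq_univ, Measure.measure_prod_null hE.compl]
    filter_upwards [hsec] with x hx using ae_eq_univ.1 (hx.trans h)

end CommutingMaps

/-- **Pivato.** If `μ` is invariant under both `σ` and a cellular automaton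
`F`, ergodic for `σ` and for `F`, and `(A^ℤ, σ, μ)` is weakly mixing (`σ × σ` is ergodic
for `μ × μ`), then `(A^ℤ, F, μ)` is weakly mixing as well. -/
theorem weakly_mixing_of_shift_implies_weakly_mixing_of_CA
    {A : Type*} [Fintype A] [MeasurableSpace A]
    [TopologicalSpace A] [DiscreteTopology A]
    (F : Config A → Config A) (hFcont : Continuous F)
    (hFshift : F ∘ shift = shift ∘ F)
    (μ : MeasureTheory.Measure (Config A)) [MeasureTheory.IsProbabilityMeasure μ]
    (hσerg : Ergodic shift μ) (hFerg : Ergodic F μ)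
    (hσwm : Ergodic (Prod.map shift shift) (μ.prod μ)) :
    Ergodic (Prod.map F F) (μ.prod μ) := by
  have hgen : MeasurableSpace.CountablyGenerated (Config A) := countablyGenerated_pi
  exact hFerg.prodMap_self_of_commute hσwm hσerg.measurable (congrFun hFshift)
end
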